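/- For all a, b, c > 0 with a + b ≥ 1, the random variable X_{a,b,c,2} exists if and only if c ≥ 3a + b. -/

import Mathlib

open MeasureTheory Real

/-- `μ` is a law of the random variable `X_{a,b,c,d}`: a probability measure on `(0,∞)`
whose fractional moments are `Γ(c)/(Γ(a)Γ(b)) · Γ(a+s)Γ(b−s)/Γ(c+d·s)` for `s ∈ (−a,b)`. -/
def IsXLaw (a b c d : ℝ) (μ : Measure ℝ) : Prop :=
  IsProbabilityMeasure μ ∧ μ (Set.Ioi (0 : ℝ))ᶜ = 0 ∧
    ∀ s ∈ Set.Ioo (-a) b,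
      ∫⁻ x, ENNReal.ofReal (x ^ s) ∂μ =
        ENNReal.ofReal (Real.Gamma c / (Real.Gamma a * Real.Gamma b) *
          (Real.Gamma (a + s) * Real.Gamma (b - s) / Real.Gamma (c + d * s)))

/-- The random variable `X_{a,b,c,d}` exists. -/
def XExists (a b c d : ℝ) : Prop :=
  ∃ μ : Measure ℝ, IsXLaw a b c d μ

/-- The rising factorial `x (x + 1) ⋯ (x + n - 1)`. -/
noncomputable def rising (x : ℝ) (n : ℕ) : ℝ := (ascPochhammer ℝ n).eval x

@[simp] lemma rising_zero (x : ℝ) : rising x 0 = 1 := by simp [rising]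

lemma rising_succ (x : ℝ) (n : ℕ) : rising x (n + 1) = rising x n * (x + n) :=
  ascPochhammer_succ_eval n x

lemma rising_pos {x : ℝ} (hx : 0 < x) (n : ℕ) : 0 < rising x n :=
  ascPochhammer_pos n x hx

lemma rising_nonneg {x : ℝ} (hx : 0 ≤ x) (n : ℕ) : 0 ≤ rising x n := by
  induction n with
  | zero => simp
  | succ n ih => rw [rising_succ]; positivity

/-- The summand of the very-well-poised `₅F₄` series at unit argument, divided by its sum. -/
noncomputable def wellPoisedTerm (a b c : ℝ) (m n : ℕ) : ℝ :=
  (-1) ^ n * (2 * n + a) * rising a n * rising b n * rising c n * m.factorial *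
    rising (1 + a - b) m * rising (1 + a - c) m /
    (a * (m - n).factorial * n.factorial * rising (1 + a - b) n * rising (1 + a - c) n *
      rising (1 + a) (m + n) * rising (1 + a - b - c) m)

section WellPoised

variable {a b c : ℝ} (ha : 0 < a) (hb : 0 < 1 + a - b) (hc : 0 < 1 + a - c)
  (hbc : 0 < 1 + a - b - c)

include ha hb hc hbc

lemma wellPoisedTerm_succ_left (n k : ℕ) :
    wellPoisedTerm a b c (n + k + 1) n = wellPoisedTerm a b c (n + k) n *
      ((n + k + 1) * (1 + a - b + (n + k)) * (1 + a - c + (n + k)) /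
        ((k + 1) * (1 + a + (n + k + n)) * (1 + a - b - c + (n + k)))) := by
  have e1 : n + k + 1 - n = k + 1 := by omega
  have e2 : n + k - n = k := by omega
  have e3 : n + k + 1 + n = n + k + n + 1 := by omega
  have h1 := rising_pos hb
  have h2 := rising_pos hc
  have h3 := rising_pos hbc
  have h4 := rising_pos (show 0 < 1 + a by positivity)
  have h5 : 0 < 1 + a - b + (n + k) := by positivity
  have h6 : 0 < 1 + a - c + (n + k) := by positivity
  have h7 : 0 < 1 + a - b - c + (n + k) := by positivity
  simp only [wellPoisedTerm, e1, e2, e3, rising_succ, Nat.factorial_succ]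
  have := h1 n; have := h2 n; have := h1 (n + k); have := h2 (n + k)
  have := h3 (n + k); have := h4 (n + k + n)
  push_cast
  field_simp

lemma wellPoisedTerm_succ_right (n k : ℕ) :
    wellPoisedTerm a b c (n + k + 1) (n + 1) = - wellPoisedTerm a b c (n + k + 1) n *
      ((2 * n + 2 + a) * (a + n) * (b + n) * (c + n) * (k + 1) /
        ((2 * n + a) * (n + 1) * (1 + a - b + n) * (1 + a - c + n) *
          (1 + a + (n + k + 1 + n)))) := by
  have e1 : n + k + 1 - n = k + 1 := by omega
  have e2 : n + k + 1 - (n + 1) = k := by omega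
  have e3 : n + k + 1 + (n + 1) = n + k + 1 + n + 1 := by omega
  have h1 := rising_pos hb
  have h2 := rising_pos hc
  have h3 := rising_pos hbc
  have h4 := rising_pos (show 0 < 1 + a by positivity)
  have h5 : 0 < 1 + a - b + n := by positivity
  have h6 : 0 < 1 + a - c + n := by positivity
  simp only [wellPoisedTerm, e1, e2, e3, rising_succ a, rising_succ b, rising_succ c,
    rising_succ _ n, rising_succ _ (n + k + 1 + n), Nat.factorial_succ, pow_succ]
  have := h1 n; have := h2 n; have := h1 (n + k + 1); have := h2 (n + k + 1)
  have := h3 (n + k + 1); have := h4 (n + k + 1 + n)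
  push_cast
  field_simp

lemma sum_wellPoisedTerm_sub (n k : ℕ) :
    ∑ i ∈ Finset.range n, (wellPoisedTerm a b c (n + k + 1) i - wellPoisedTerm a b c (n + k) i) =
      - wellPoisedTerm a b c (n + k) n * (n * (a - b + n) * (a - c + n) /
        ((a + 2 * n) * (k + 1) * (1 + a - b - c + (n + k)))) := by
  induction n generalizing k with
  | zero => simp
  | succ n ih =>
    have h := ih (k + 1)
    have e : n + (k + 1) = n + 1 + k := by omega
    rw [e] at h
    rw [Finset.sum_range_succ, h, ← e, wellPoisedTerm_succ_left ha hb hc hbc n (k + 1),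
      show n + (k + 1) = n + k + 1 by omega, wellPoisedTerm_succ_right ha hb hc hbc n k]
    have h5 : 0 < 1 + a - b + n := by positivity
    have h6 : 0 < 1 + a - c + n := by positivity
    have h7 : 0 < 1 + a - b - c + (n + (k + 1)) := by positivity
    push_cast
    rw [show a - b + ((n : ℝ) + 1) = 1 + a - b + n by ring,
      show a - c + ((n : ℝ) + 1) = 1 + a - c + n by ring,
      show 1 + a - b - c + ((n : ℝ) + 1 + k) = 1 + a - b - c + (n + (k + 1)) by ring]
    generalize wellPoisedTerm a b c (n + k + 1) n = U
    field_simp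
    ring

/-- Dougall's summation of the terminating very-well-poised `₅F₄`. -/
lemma sum_wellPoisedTerm (m : ℕ) :
    ∑ n ∈ Finset.range (m + 1), wellPoisedTerm a b c m n = 1 := by
  induction m with
  | zero => simp [wellPoisedTerm, ha.ne']
  | succ m ih =>
    have h := sum_wellPoisedTerm_sub ha hb hc hbc m 0
    rw [Finset.sum_sub_distrib] at h
    rw [Finset.sum_range_succ] at ih ⊢
    rw [Finset.sum_range_succ]
    have l := wellPoisedTerm_succ_left ha hb hc hbc m 0
    have r := wellPoisedTerm_succ_right ha hb hc hbc m 0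
    simp only [add_zero, Nat.cast_zero, zero_add] at h l r
    rw [r, l]
    have : ∑ n ∈ Finset.range m, wellPoisedTerm a b c (m + 1) n =
      1 - wellPoisedTerm a b c m m + - wellPoisedTerm a b c m m * (m * (a - b + m) * (a - c + m) /
        ((a + 2 * m) * 1 * (1 + a - b - c + m))) := by linarith
    rw [this]
    have h5 : 0 < 1 + a - b + m := by positivity
    have h6 : 0 < 1 + a - c + m := by positivity
    have h7 : 0 < 1 + a - b - c + m := by positivity
    generalize wellPoisedTerm a b c m m = U
    field_simp
    ring

end WellPoised

/-- The coefficients of `₀F₁(; β; z / 4)`. -/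
noncomputable def besselCoeff (β : ℝ) (i : ℕ) : ℝ := (1 / 4) ^ i / (i.factorial * rising β i)

/-- The coefficients of `₁F₂(β - 1/2; β, 2β - 1; z)`. -/
noncomputable def besselSqCoeff (β : ℝ) (k : ℕ) : ℝ :=
  rising (β - 1 / 2) k / (k.factorial * rising β k * rising (2 * β - 1) k)

section BesselSq

variable {β : ℝ} (hβ : 1 / 2 < β)

include hβ

lemma besselCoeff_succ (j : ℕ) :
    besselCoeff β (j + 1) = besselCoeff β j * (1 / 4 / ((j + 1) * (β + j))) := by
  have h0 : 0 < β := by linarith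
  have := rising_pos h0 j
  simp only [besselCoeff, rising_succ, Nat.factorial_succ, pow_succ]
  push_cast
  field_simp

lemma besselSqCoeff_pos (k : ℕ) : 0 < besselSqCoeff β k := by
  have := rising_pos (show 0 < β by linarith) k
  have := rising_pos (show 0 < β - 1 / 2 by linarith) k
  have := rising_pos (show 0 < 2 * β - 1 by linarith) k
  unfold besselSqCoeff
  positivity

lemma besselSqCoeff_succ (k : ℕ) :
    besselSqCoeff β (k + 1) =
      besselSqCoeff β k * ((β - 1 / 2 + k) / ((k + 1) * (β + k) * (2 * β - 1 + k))) := by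
  have h1 : 0 < β := by linarith
  have h2 : 0 < β - 1 / 2 := by linarith
  have h3 : 0 < 2 * β - 1 := by linarith
  have := rising_pos h1 k
  have := rising_pos h2 k
  have := rising_pos h3 k
  have : 0 < β - 1 / 2 + k := by positivity
  have : 0 < 2 * β - 1 + k := by positivity
  simp only [besselSqCoeff, rising_succ, Nat.factorial_succ]
  push_cast
  field_simp

lemma sum_besselCoeff_mul_sub (i j : ℕ) :
    (∑ l ∈ Finset.range i, besselCoeff β l * besselCoeff β (i + j + 1 - l)) /
        besselSqCoeff β (i + j + 1) -
      (∑ l ∈ Finset.range i, besselCoeff β l * besselCoeff β (i + j - l)) /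
        besselSqCoeff β (i + j) =
      besselCoeff β i * besselCoeff β j / besselSqCoeff β (i + j) *
        (i * (β + i - 1) * (i - β - 1 / 2 - 3 * (i + j) / 2) /
          ((j + 1) * (β + j) * (2 * β + 2 * (i + j) - 1))) := by
  induction i generalizing j with
  | zero => simp
  | succ i ih =>
    have h := ih (j + 1)
    rw [show i + (j + 1) = i + j + 1 by omega] at h
    rw [show i + 1 + j = i + j + 1 by omega, Finset.sum_range_succ, Finset.sum_range_succ,
      add_div, add_div, add_sub_add_comm, h, show i + j + 1 + 1 - i = j + 1 + 1 by omega,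
      show i + j + 1 - i = j + 1 by omega, besselCoeff_succ hβ (j + 1), besselCoeff_succ hβ j,
      besselCoeff_succ hβ i, besselSqCoeff_succ hβ (i + j + 1)]
    have := besselSqCoeff_pos hβ (i + j + 1)
    generalize besselSqCoeff β (i + j + 1) = S at *
    generalize besselCoeff β i = A
    generalize besselCoeff β j = B
    obtain ⟨δ, rfl⟩ : ∃ δ, β = δ + 1 / 2 := ⟨β - 1 / 2, by ring⟩
    have hδ : 0 < δ := by linarith
    push_cast
    rw [show δ + 1 / 2 - 1 / 2 + ((i : ℝ) + j + 1) = δ + (i + j + 1) by ring,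
      show 2 * (δ + 1 / 2) - 1 + ((i : ℝ) + j + 1) = 2 * δ + (i + j + 1) by ring,
      show 2 * (δ + 1 / 2) + 2 * ((i : ℝ) + (j + 1)) - 1 = 2 * (δ + (i + j + 1)) by ring,
      show 2 * (δ + 1 / 2) + 2 * ((i : ℝ) + 1 + j) - 1 = 2 * (δ + (i + j + 1)) by ring]
    field_simp
    ring

/-- The Cauchy square of `₀F₁(; β; z / 4)` is `₁F₂(β - 1/2; β, 2β - 1; z)`. -/
lemma sum_besselCoeff_mul (k : ℕ) :
    ∑ i ∈ Finset.range (k + 1), besselCoeff β i * besselCoeff β (k - i) = besselSqCoeff β k := by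
  induction k with
  | zero => simp [besselCoeff, besselSqCoeff]
  | succ k ih =>
    have h := sum_besselCoeff_mul_sub hβ k 0
    rw [Finset.sum_range_succ] at ih ⊢
    rw [Finset.sum_range_succ]
    have := besselSqCoeff_pos hβ k
    have := besselSqCoeff_pos hβ (k + 1)
    rw [← eq_sub_iff_add_eq] at ih
    simp only [add_zero, Nat.cast_zero, zero_add, Nat.sub_self,
      show k + 1 - k = 1 by omega] at h ih ⊢
    rw [ih, sub_eq_iff_eq_add, div_eq_iff (by positivity)] at h
    rw [h, besselCoeff_succ hβ k, show besselCoeff β 1 = 1 / 4 / β by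
      rw [← zero_add 1, besselCoeff_succ hβ 0]; simp [besselCoeff],
      show besselCoeff β 0 = 1 by simp [besselCoeff], besselSqCoeff_succ hβ k]
    generalize besselSqCoeff β k = S at *
    generalize besselCoeff β k = A
    obtain ⟨δ, rfl⟩ : ∃ δ, β = δ + 1 / 2 := ⟨β - 1 / 2, by ring⟩
    have hδ : 0 < δ := by linarith
    rw [show δ + 1 / 2 - 1 / 2 + (k : ℝ) = δ + k by ring,
      show 2 * (δ + 1 / 2) - 1 + (k : ℝ) = 2 * δ + k by ring,
      show 2 * (δ + 1 / 2) + 2 * (k : ℝ) - 1 = 2 * (δ + k) by ring]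
    rcases Nat.eq_zero_or_pos k with rfl | hk
    · simp
      field_simp
      ring
    · field_simp
      ring

end BesselSq

lemma rising_le_rising {x y : ℝ} (hx : 0 ≤ x) (h : x ≤ y) (n : ℕ) : rising x n ≤ rising y n := by
  induction n with
  | zero => simp
  | succ n ih =>
    rw [rising_succ, rising_succ]
    have := rising_nonneg (hx.trans h) n
    gcongr

lemma one_le_rising {x : ℝ} (hx : 1 ≤ x) (n : ℕ) : 1 ≤ rising x n := by
  induction n with
  | zero => simp
  | succ n ih =>
    rw [rising_succ]
    exact one_le_mul_of_one_le_of_one_le ih (le_add_of_le_of_nonneg hx n.cast_nonneg)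

lemma rising_mul_rising_le {x : ℝ} (hx : 0 ≤ x) (m n : ℕ) :
    rising x m * rising x n ≤ rising x (m + n) := by
  induction n with
  | zero => simp
  | succ n ih =>
    rw [← add_assoc, rising_succ, rising_succ, ← mul_assoc]
    have := rising_nonneg hx (m + n)
    push_cast
    gcongr
    linarith [(m.cast_nonneg : (0 : ℝ) ≤ m)]

lemma rising_one_add_mul (x : ℝ) (n : ℕ) : rising (1 + x) n * x = rising x n * (x + n) := by
  induction n with
  | zero => simp
  | succ n ih =>
    rw [rising_succ, rising_succ, mul_right_comm, ih]
    push_cast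
    ring

lemma besselCoeff_nonneg {β : ℝ} (hβ : 1 ≤ β) (i : ℕ) : 0 ≤ besselCoeff β i := by
  have := one_le_rising hβ i
  unfold besselCoeff
  positivity

lemma besselCoeff_le {β : ℝ} (hβ : 1 ≤ β) (i : ℕ) : besselCoeff β i ≤ 1 / i.factorial := by
  have := one_le_rising hβ i
  unfold besselCoeff
  gcongr
  · exact pow_le_one₀ (by norm_num) (by norm_num)
  · exact le_mul_of_one_le_right (by positivity) this

lemma besselSqCoeff_le {β : ℝ} (hβ : 1 ≤ β) (k : ℕ) : besselSqCoeff β k ≤ 1 / k.factorial := by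
  have h1 := one_le_rising (show 1 ≤ 2 * β - 1 by linarith) k
  have h2 := rising_le_rising (show 0 ≤ β - 1 / 2 by linarith) (show β - 1 / 2 ≤ β by linarith) k
  have h3 := one_le_rising hβ k
  unfold besselSqCoeff
  rw [div_le_div_iff₀ (by positivity) (by positivity), one_mul, mul_comm, mul_assoc]
  gcongr
  exact h2.trans (le_mul_of_one_le_right (by positivity) h1)

lemma summable_mul_pow_of_le_inv_factorial {u : ℕ → ℝ} {C : ℝ} (h0 : ∀ n, 0 ≤ u n)
    (h : ∀ n, u n ≤ C * (1 / n.factorial)) (x : ℝ) : Summable fun n ↦ ‖u n * x ^ n‖ := by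
  refine Summable.of_nonneg_of_le (fun _ ↦ norm_nonneg _) (fun n ↦ ?_)
    ((Real.summable_pow_div_factorial |x|).mul_left C)
  rw [norm_mul, norm_pow, Real.norm_eq_abs, Real.norm_eq_abs, abs_of_nonneg (h0 n)]
  calc u n * |x| ^ n ≤ C * (1 / n.factorial) * |x| ^ n := by gcongr; exact h n
    _ = _ := by ring

lemma tsum_besselSqCoeff_nonneg {β : ℝ} (hβ : 1 ≤ β) (x : ℝ) :
    0 ≤ ∑' k, besselSqCoeff β k * x ^ k := by
  have hs := summable_mul_pow_of_le_inv_factorial (C := 1) (besselCoeff_nonneg hβ)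
    (by simpa using besselCoeff_le hβ) x
  have h := tsum_mul_tsum_eq_tsum_sum_range_of_summable_norm hs hs
  have e : ∀ k, ∑ i ∈ Finset.range (k + 1), besselCoeff β i * x ^ i *
      (besselCoeff β (k - i) * x ^ (k - i)) = besselSqCoeff β k * x ^ k := by
    intro k
    rw [← sum_besselCoeff_mul (by linarith) k, Finset.sum_mul]
    refine Finset.sum_congr rfl fun i hi ↦ ?_
    rw [mul_mul_mul_comm, ← pow_add, Nat.add_sub_of_le (Finset.mem_range_succ_iff.mp hi)]
  simp only [e] at h
  rw [← h]
  exact mul_self_nonneg _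

/-- The coefficients of `₁F₂(α; 3α/2, (3α + 1)/2; z)`. -/
noncomputable def hypCoeff (α : ℝ) (m : ℕ) : ℝ :=
  rising α m / (m.factorial * rising (3 * α / 2) m * rising (3 * α / 2 + 1 / 2) m)

/-- The coefficients of `₁F₂(α; 3α/2, (3α + 1)/2; -x)` in its expansion in squares of Bessel
functions. -/
noncomputable def gasperCoeff (α : ℝ) (n : ℕ) : ℝ :=
  (-1) ^ n * (hypCoeff α n * wellPoisedTerm (2 * α - 1) (α / 2) ((α - 1) / 2) n n)

section Gasper

variable {α : ℝ} (hα : 1 ≤ α)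

include hα

lemma hypCoeff_pos (m : ℕ) : 0 < hypCoeff α m := by
  have := rising_pos (show 0 < α by linarith) m
  have := rising_pos (show 0 < 3 * α / 2 by linarith) m
  have := rising_pos (show 0 < 3 * α / 2 + 1 / 2 by linarith) m
  unfold hypCoeff
  positivity

lemma hypCoeff_le (m : ℕ) : hypCoeff α m ≤ 1 / m.factorial := by
  have h1 := one_le_rising (show 1 ≤ 3 * α / 2 + 1 / 2 by linarith) m
  have h2 := rising_le_rising (show 0 ≤ α by linarith) (show α ≤ 3 * α / 2 by linarith) m
  have h3 := one_le_rising (show 1 ≤ 3 * α / 2 by linarith) m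
  unfold hypCoeff
  rw [div_le_div_iff₀ (by positivity) (by positivity), one_mul, mul_comm, mul_assoc]
  gcongr
  exact h2.trans (le_mul_of_one_le_right (by positivity) h1)

lemma hypCoeff_mul_wellPoisedTerm (n k : ℕ) :
    hypCoeff α (n + k) * wellPoisedTerm (2 * α - 1) (α / 2) ((α - 1) / 2) (n + k) n =
      (-1) ^ n * (gasperCoeff α n * besselSqCoeff (α + n + 1 / 2) k) := by
  induction k with
  | zero => simp [gasperCoeff, besselSqCoeff, ← mul_assoc, ← mul_pow]
  | succ k ih =>
    have hn : (0 : ℝ) ≤ n := n.cast_nonneg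
    rw [besselSqCoeff_succ (by linarith), ← mul_assoc (gasperCoeff α n), ← mul_assoc ((-1 : ℝ) ^ n),
      ← ih, ← add_assoc, wellPoisedTerm_succ_left (by linarith) (by linarith) (by linarith)
      (by linarith)]
    have h1 : 0 < α := by linarith
    have e : hypCoeff α (n + k + 1) = hypCoeff α (n + k) * ((α + (n + k)) /
        ((n + k + 1) * (3 * α / 2 + (n + k)) * (3 * α / 2 + 1 / 2 + (n + k)))) := by
      have := rising_pos (show 0 < 3 * α / 2 by linarith) (n + k)
      have := rising_pos (show 0 < 3 * α / 2 + 1 / 2 by linarith) (n + k)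
      simp only [hypCoeff, rising_succ, Nat.factorial_succ]
      push_cast
      field_simp
    rw [e, show 1 + (2 * α - 1) - α / 2 + (n + k : ℝ) = 3 * α / 2 + (n + k) by ring,
      show 1 + (2 * α - 1) - (α - 1) / 2 + (n + k : ℝ) = 3 * α / 2 + 1 / 2 + (n + k) by ring,
      show 1 + (2 * α - 1) + (n + k + n : ℝ) = 2 * α + (n + k + n) by ring,
      show 1 + (2 * α - 1) - α / 2 - (α - 1) / 2 + (n + k : ℝ) = α + 1 / 2 + (n + k) by ring,
      show α + n + 1 / 2 - 1 / 2 + (k : ℝ) = α + (n + k) by ring,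
      show 2 * (α + n + 1 / 2) - 1 + (k : ℝ) = 2 * α + (n + k + n) by ring]
    generalize hypCoeff α (n + k) = A
    generalize wellPoisedTerm _ _ _ _ _ = B
    field_simp
    ring

lemma gasperCoeff_eq (n : ℕ) :
    gasperCoeff α n = hypCoeff α n * ((2 * n + (2 * α - 1)) * rising (2 * α - 1) n *
      rising (α / 2) n * rising ((α - 1) / 2) n /
        ((2 * α - 1) * rising (2 * α) (n + n) * rising (α + 1 / 2) n)) := by
  have := rising_pos (show 0 < 3 * α / 2 by linarith) n
  have := rising_pos (show 0 < 3 * α / 2 + 1 / 2 by linarith) n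
  have := rising_pos (show 0 < 2 * α by linarith) (n + n)
  have := rising_pos (show 0 < α + 1 / 2 by linarith) n
  have hs : ((-1 : ℝ) ^ n) * (-1) ^ n = 1 := by rw [← mul_pow]; simp
  have : 0 < 2 * α - 1 := by linarith
  simp only [gasperCoeff, wellPoisedTerm]
  rw [show 1 + (2 * α - 1) - α / 2 = 3 * α / 2 by ring,
      show 1 + (2 * α - 1) - (α - 1) / 2 = 3 * α / 2 + 1 / 2 by ring,
      show 1 + (2 * α - 1) = 2 * α by ring,
      show 3 * α / 2 - (α - 1) / 2 = α + 1 / 2 by ring, Nat.sub_self, Nat.factorial_zero]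
  generalize (-1 : ℝ) ^ n = ε at *
  generalize 2 * α - 1 = a at *
  generalize rising (3 * α / 2) n = r₁ at *
  generalize rising (3 * α / 2 + 1 / 2) n = r₂ at *
  generalize rising (α + 1 / 2) n = r₃ at *
  generalize rising (α / 2) n = r₄ at *
  generalize rising ((α - 1) / 2) n = r₅ at *
  generalize rising a n = r₆ at *
  generalize rising (2 * α) (n + n) = r₇ at *
  generalize hypCoeff α n = h at *
  push_cast
  field_simp
  linear_combination h * r₄ * r₅ * r₆ * hs

lemma gasperCoeff_nonneg (n : ℕ) : 0 ≤ gasperCoeff α n := by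
  have := hypCoeff_pos hα n
  have := rising_pos (show 0 < 2 * α by linarith) (n + n)
  have := rising_pos (show 0 < α + 1 / 2 by linarith) n
  have := rising_nonneg (show 0 ≤ 2 * α - 1 by linarith) n
  have := rising_nonneg (show 0 ≤ α / 2 by linarith) n
  have := rising_nonneg (show 0 ≤ (α - 1) / 2 by linarith) n
  have : 0 < 2 * α - 1 := by linarith
  rw [gasperCoeff_eq hα]
  positivity

lemma gasperCoeff_le (n : ℕ) : gasperCoeff α n ≤ 2 * (1 / n.factorial) := by
  have h1 := rising_mul_rising_le (show 0 ≤ 2 * α by linarith) n n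
  have h2 := rising_pos (show 0 < α + 1 / 2 by linarith) n
  have h3 := rising_nonneg (show 0 ≤ (α - 1) / 2 by linarith) n
  have h4 := rising_le_rising (show 0 ≤ α / 2 by linarith) (show α / 2 ≤ α + 1 / 2 by linarith) n
  have h5 := rising_le_rising (show 0 ≤ (α - 1) / 2 by linarith)
    (show (α - 1) / 2 ≤ 2 * α by linarith) n
  have h6 := rising_one_add_mul (2 * α - 1) n
  rw [show 1 + (2 * α - 1) = 2 * α by ring] at h6
  have h7 := rising_nonneg (show 0 ≤ 2 * α - 1 by linarith) n
  have h8 := rising_pos (show 0 < 2 * α by linarith) (n + n)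
  have h9 := rising_pos (show 0 < 2 * α by linarith) n
  have ha : 0 < 2 * α - 1 := by linarith
  have h10 := rising_nonneg (show 0 ≤ α / 2 by linarith) n
  rw [gasperCoeff_eq hα, mul_comm (2 : ℝ) (1 / (n.factorial : ℝ))]
  refine mul_le_mul (hypCoeff_le hα n) ?_ (by positivity) (by positivity)
  have : (2 * n + (2 * α - 1)) * rising (2 * α - 1) n ≤
      2 * (rising (2 * α) n * (2 * α - 1)) := by
    rw [h6]; nlinarith
  rw [div_le_iff₀ (by positivity)]
  calc (2 * n + (2 * α - 1)) * rising (2 * α - 1) n * rising (α / 2) n * rising ((α - 1) / 2) n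
      ≤ 2 * (rising (2 * α) n * (2 * α - 1)) * rising (α + 1 / 2) n * rising (2 * α) n := by
        gcongr
    _ = 2 * ((2 * α - 1) * (rising (2 * α) n * rising (2 * α) n) * rising (α + 1 / 2) n) := by
        ring
    _ ≤ _ := by gcongr

/-- Gasper's positivity theorem: `₁F₂(α; 3α/2, (3α + 1)/2; -x) ≥ 0` for `α ≥ 1` and `x ≥ 0`. -/
lemma tsum_hypCoeff_nonneg {x : ℝ} (hx : 0 ≤ x) : 0 ≤ ∑' m, hypCoeff α m * (-x) ^ m := by
  have hβ : ∀ n : ℕ, 1 ≤ α + n + 1 / 2 := fun n ↦ by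
    linarith [(n.cast_nonneg : (0 : ℝ) ≤ n)]
  let g : ℕ × ℕ → ℝ := fun p ↦
    gasperCoeff α p.1 * x ^ p.1 * (besselSqCoeff (α + p.1 + 1 / 2) p.2 * (-x) ^ p.2)
  have hg : Summable g := by
    have h1 := summable_mul_pow_of_le_inv_factorial (gasperCoeff_nonneg hα) (gasperCoeff_le hα) x
    have h2 := summable_mul_pow_of_le_inv_factorial (u := fun k ↦ 1 / k.factorial) (C := 1)
      (fun k ↦ by positivity) (fun k ↦ by simp) x
    refine .of_norm_bounded (summable_mul_of_summable_norm h1.norm h2.norm) fun p ↦ ?_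
    simp only [g, norm_mul, norm_pow, norm_neg]
    rw [Real.norm_of_nonneg (besselSqCoeff_pos (by linarith [hβ p.1]) _).le,
      Real.norm_of_nonneg (show (0 : ℝ) ≤ 1 / (p.2.factorial : ℝ) by positivity)]
    gcongr
    exact besselSqCoeff_le (hβ _) _
  have hsum (m : ℕ) : hypCoeff α m * (-x) ^ m = ∑ p ∈ Finset.HasAntidiagonal.antidiagonal m, g p := by
    rw [Finset.Nat.sum_antidiagonal_eq_sum_range_succ_mk,
      ← mul_one (hypCoeff α m), ← sum_wellPoisedTerm (a := 2 * α - 1) (b := α / 2)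
      (c := (α - 1) / 2) (by linarith) (by linarith) (by linarith) (by linarith) m,
      Finset.mul_sum, Finset.sum_mul]
    refine Finset.sum_congr rfl fun n hn ↦ ?_
    obtain ⟨k, rfl⟩ := Nat.exists_eq_add_of_le (Finset.mem_range_succ_iff.mp hn)
    have hs : ((-1 : ℝ) ^ n) * (-1) ^ n = 1 := by rw [← mul_pow]; simp
    rw [hypCoeff_mul_wellPoisedTerm hα, Nat.add_sub_cancel_left]
    simp only [g]
    rw [pow_add, neg_pow x n]
    linear_combination gasperCoeff α n * besselSqCoeff (α + n + 1 / 2) k * x ^ n * (-x) ^ k * hs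
  simp only [hsum]
  have hg' := (Finset.HasAntidiagonal.sigmaAntidiagonalEquivProd (A := ℕ)).summable_iff.mpr hg
  have key : ∑' m, ∑ p ∈ Finset.HasAntidiagonal.antidiagonal m, g p = ∑' p, g p := by
    have h := hg'.tsum_sigma
    simp only [Function.comp_apply] at h
    rw [← (Finset.HasAntidiagonal.sigmaAntidiagonalEquivProd (A := ℕ)).tsum_eq g, h]
    refine tsum_congr fun m ↦ ?_
    rw [← Finset.tsum_subtype]
    rfl
  rw [key, hg.tsum_prod]
  refine tsum_nonneg fun n ↦ ?_
  simp only [g]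
  rw [tsum_mul_left]
  have := gasperCoeff_nonneg hα n
  have := tsum_besselSqCoeff_nonneg (hβ n) (-x)
  positivity

end Gasper

lemma eq_ofReal_div_of_ofReal_mul_eq {k y : ℝ} {I : ENNReal} (hk : 0 < k)
    (h : ENNReal.ofReal k * I = ENNReal.ofReal y) : I = ENNReal.ofReal (y / k) := by
  rw [ENNReal.ofReal_div_of_pos hk, ← h, mul_comm, ENNReal.mul_div_cancel_right
    (ENNReal.ofReal_pos.mpr hk).ne' ENNReal.ofReal_ne_top]

section Integrals

open Set ProbabilityTheory

lemma setLIntegral_ofReal_of_setIntegral_eq {s : Set ℝ} (hs : MeasurableSet s) {f : ℝ → ℝ} {I : ℝ}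
    (hI : ∫ x in s, f x = I) (hpos : 0 < I) (hf : ∀ x ∈ s, 0 ≤ f x) :
    ∫⁻ x in s, ENNReal.ofReal (f x) = ENNReal.ofReal I := by
  rw [← hI, ofReal_integral_eq_lintegral_ofReal]
  · exact .of_integral_ne_zero (by rw [hI]; exact hpos.ne')
  · exact ae_restrict_of_forall_mem hs hf

lemma lintegral_rpow_mul_exp_neg_mul_Ioi {q r : ℝ} (hq : 0 < q) (hr : 0 < r) :
    ∫⁻ x in Ioi (0 : ℝ), ENNReal.ofReal (x ^ (q - 1) * exp (-(r * x))) =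
      ENNReal.ofReal (r ^ (-q) * Gamma q) := by
  have := Gamma_pos_of_pos hq
  refine setLIntegral_ofReal_of_setIntegral_eq measurableSet_Ioi ?_ (by positivity)
    fun x hx ↦ mul_nonneg (rpow_nonneg (le_of_lt hx) _) (exp_nonneg _)
  rw [integral_rpow_mul_exp_neg_mul_Ioi hq hr, one_div, inv_rpow hr.le, rpow_neg hr.le]

lemma lintegral_Ioi_comp_inv (g : ℝ → ENNReal) :
    ∫⁻ x in Ioi (0 : ℝ), g x = ∫⁻ x in Ioi (0 : ℝ), ENNReal.ofReal (x ^ (-2 : ℝ)) * g x⁻¹ := by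
  have h := lintegral_image_eq_lintegral_abs_deriv_mul (s := Ioi (0 : ℝ)) (f := fun x ↦ x⁻¹)
    (f' := fun x ↦ -(x ^ 2)⁻¹) measurableSet_Ioi
    (fun x hx ↦ (hasDerivAt_inv (ne_of_gt hx)).hasDerivWithinAt) inv_injective.injOn g
  have e : Set.image (fun x : ℝ ↦ x⁻¹) (Ioi 0) = Ioi 0 := by
    ext x
    simp
  rw [e] at h
  rw [h]
  refine setLIntegral_congr_fun measurableSet_Ioi fun x hx ↦ ?_
  have hx' : 0 < x := hx
  rw [abs_neg, abs_of_pos (by positivity), rpow_neg hx'.le, rpow_two]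

lemma lintegral_rpow_mul_exp_neg_div_Ioi {q u : ℝ} (hq : 0 < q) (hu : 0 < u) :
    ∫⁻ p in Ioi (0 : ℝ), ENNReal.ofReal (p ^ (-q - 1) * exp (-(u / p))) =
      ENNReal.ofReal (u ^ (-q) * Gamma q) := by
  rw [lintegral_Ioi_comp_inv, ← lintegral_rpow_mul_exp_neg_mul_Ioi hq hu]
  refine setLIntegral_congr_fun measurableSet_Ioi fun x hx ↦ ?_
  have hx' : 0 < x := hx
  rw [← ENNReal.ofReal_mul (by positivity), ← mul_assoc, inv_rpow hx'.le, ← rpow_neg hx'.le,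
    ← rpow_add hx', div_inv_eq_mul]
  ring_nf

lemma lintegral_beta_Ioo {α β : ℝ} (hα : 0 < α) (hβ : 0 < β) :
    ∫⁻ u in Ioo (0 : ℝ) 1, ENNReal.ofReal (u ^ (α - 1) * (1 - u) ^ (β - 1)) =
      ENNReal.ofReal (beta α β) := by
  have hb := beta_pos hα hβ
  have h := lintegral_betaPDF_eq_one hα hβ
  rw [lintegral_betaPDF] at h
  simp only [mul_assoc] at h
  simp only [ENNReal.ofReal_mul (show 0 ≤ 1 / beta α β by positivity)] at h
  rw [lintegral_const_mul _ (by fun_prop)] at h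
  rw [eq_ofReal_div_of_ofReal_mul_eq (by positivity) (h.trans ENNReal.ofReal_one.symm),
    one_div_one_div]

lemma lintegral_rpow_mul_one_add_sq_rpow {A B : ℝ} (hA : 0 < A) (hB : 0 < B) :
    ∫⁻ p in Ioi (0 : ℝ), ENNReal.ofReal (p ^ (2 * A - 1) * (1 + p ^ 2) ^ (-(A + B))) =
      ENNReal.ofReal (Gamma A * Gamma B / (2 * Gamma (A + B))) := by
  have hGA := Gamma_pos_of_pos hA
  have hGB := Gamma_pos_of_pos hB
  have hG := Gamma_pos_of_pos (add_pos hA hB)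
  have key : ∫⁻ p in Ioi (0 : ℝ), ∫⁻ x in Ioi (0 : ℝ),
      ENNReal.ofReal (p ^ (2 * A - 1) * (x ^ (A + B - 1) * exp (-((1 + p ^ 2) * x)))) =
      ∫⁻ x in Ioi (0 : ℝ), ∫⁻ p in Ioi (0 : ℝ),
      ENNReal.ofReal (p ^ (2 * A - 1) * (x ^ (A + B - 1) * exp (-((1 + p ^ 2) * x)))) :=
    lintegral_lintegral_swap (Measurable.aemeasurable (by fun_prop))
  have h1 : ∀ p ∈ Ioi (0 : ℝ), ∫⁻ x in Ioi (0 : ℝ),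
      ENNReal.ofReal (p ^ (2 * A - 1) * (x ^ (A + B - 1) * exp (-((1 + p ^ 2) * x)))) =
      ENNReal.ofReal (Gamma (A + B)) *
        ENNReal.ofReal (p ^ (2 * A - 1) * (1 + p ^ 2) ^ (-(A + B))) := by
    intro p hp
    have hp' : 0 < p := hp
    simp only [ENNReal.ofReal_mul (show 0 ≤ p ^ (2 * A - 1) by positivity)]
    rw [lintegral_const_mul _ (by fun_prop), lintegral_rpow_mul_exp_neg_mul_Ioi (by positivity)
      (by positivity), ENNReal.ofReal_mul (by positivity)]
    ring
  have h2 : ∀ x ∈ Ioi (0 : ℝ), ∫⁻ p in Ioi (0 : ℝ),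
      ENNReal.ofReal (p ^ (2 * A - 1) * (x ^ (A + B - 1) * exp (-((1 + p ^ 2) * x)))) =
      ENNReal.ofReal (Gamma A / 2) * ENNReal.ofReal (x ^ (B - 1) * exp (-(1 * x))) := by
    intro x hx
    have hx' : 0 < x := hx
    have e : ∀ p ∈ Ioi (0 : ℝ),
        ENNReal.ofReal (p ^ (2 * A - 1) * (x ^ (A + B - 1) * exp (-((1 + p ^ 2) * x)))) =
        ENNReal.ofReal (x ^ (A + B - 1) * exp (-x)) *
          ENNReal.ofReal (p ^ (2 * A - 1) * exp (-x * p ^ (2 : ℝ))) := by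
      intro p hp
      rw [← ENNReal.ofReal_mul (by positivity), rpow_two, show -((1 + p ^ 2) * x) =
        -x + -x * p ^ 2 by ring, exp_add]
      ring_nf
    rw [setLIntegral_congr_fun measurableSet_Ioi e, lintegral_const_mul _ (by fun_prop),
      setLIntegral_ofReal_of_setIntegral_eq measurableSet_Ioi
      (integral_rpow_mul_exp_neg_mul_rpow two_pos (by linarith) hx') ?_
      fun p hp ↦ mul_nonneg (rpow_nonneg (le_of_lt hp) _) (exp_nonneg _),
      ← ENNReal.ofReal_mul (by positivity), ← ENNReal.ofReal_mul (by positivity)]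
    · rw [show (2 * A - 1 + 1) / 2 = A by ring, show -(2 * A - 1 + 1) / 2 = -A by ring,
        show B - 1 = A + B - 1 + -A by ring, rpow_add hx' _ (-A)]
      ring_nf
    · rw [show (2 * A - 1 + 1) / 2 = A by ring]
      positivity
  rw [setLIntegral_congr_fun measurableSet_Ioi h1, setLIntegral_congr_fun measurableSet_Ioi h2,
    lintegral_const_mul _ (by fun_prop), lintegral_const_mul _ (by fun_prop),
    lintegral_rpow_mul_exp_neg_mul_Ioi hB one_pos, one_rpow, one_mul] at key
  rw [← ENNReal.ofReal_mul (by positivity)] at key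
  rw [eq_ofReal_div_of_ofReal_mul_eq hG key]
  congr 1
  field_simp

end Integrals

lemma Gamma_add_natCast {x : ℝ} (hx : 0 < x) (n : ℕ) : Gamma (x + n) = rising x n * Gamma x := by
  induction n with
  | zero => simp
  | succ n ih =>
    rw [rising_succ, Nat.cast_succ, ← add_assoc, Gamma_add_one (by positivity), ih]
    ring

section Laplace

open Set ProbabilityTheory

lemma integrable_tsum_of_summable_integral_norm {μ : Measure ℝ} {F : ℕ → ℝ → ℝ}
    (hF : ∀ i, Integrable (F i) μ) (hsum : Summable fun i ↦ ∫ a, ‖F i a‖ ∂μ)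
    (hm : AEStronglyMeasurable (fun a ↦ ∑' i, F i a) μ) : Integrable (fun a ↦ ∑' i, F i a) μ := by
  refine ⟨hm, ?_⟩
  calc ∫⁻ a, ‖∑' i, F i a‖ₑ ∂μ ≤ ∫⁻ a, ∑' i, ‖F i a‖ₑ ∂μ :=
        lintegral_mono fun a ↦ enorm_tsum_le_tsum_enorm
    _ = ∑' i, ENNReal.ofReal (∫ a, ‖F i a‖ ∂μ) := by
        rw [lintegral_tsum fun i ↦ (hF i).1.enorm]
        exact tsum_congr fun i ↦ (ofReal_integral_norm_eq_lintegral_enorm (hF i)).symm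
    _ < ⊤ := hsum.tsum_ofReal_ne_top.lt_top

lemma lintegral_tsum_mul_pow_mul {s : Set ℝ} (hs : MeasurableSet s) (hs0 : s ⊆ Ioi 0)
    {w : ℝ → ℝ} (hw : Measurable w) (hw0 : ∀ x ∈ s, 0 ≤ w x) {M u : ℕ → ℝ}
    (hM : ∀ m, ∫ x in s, x ^ m * w x = M m) (hM0 : ∀ m, 0 < M m)
    (hsum : Summable fun m ↦ |u m| * M m) (h0 : ∀ x ∈ s, 0 ≤ ∑' m, u m * x ^ m) :
    ∫⁻ x in s, ENNReal.ofReal ((∑' m, u m * x ^ m) * w x) = ENNReal.ofReal (∑' m, u m * M m) := by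
  set F : ℕ → ℝ → ℝ := fun m x ↦ u m * (x ^ m * w x) with hF
  have e : ∀ x, (∑' m, u m * x ^ m) * w x = ∑' m, F m x := by
    intro x
    simp only [hF, ← mul_assoc, tsum_mul_right]
  have hint : ∀ m, Integrable (F m) (volume.restrict s) := fun m ↦
    Integrable.const_mul (.of_integral_ne_zero (by rw [hM]; exact (hM0 m).ne')) _
  have hnorm : ∀ m, ∫ x in s, ‖F m x‖ = |u m| * M m := by
    intro m
    rw [← hM, ← integral_const_mul]
    refine setIntegral_congr_fun hs fun x hx ↦ ?_
    have := hw0 x hx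
    have : 0 < x := hs0 hx
    simp only [hF, norm_mul, Real.norm_eq_abs, abs_pow]
    rw [abs_of_pos ‹0 < x›, abs_of_nonneg ‹0 ≤ w x›]
  have hsum' : Summable fun m ↦ ∫ x in s, ‖F m x‖ := by simpa only [hnorm] using hsum
  have hmeas : AEStronglyMeasurable (fun x ↦ ∑' m, F m x) (volume.restrict s) :=
    (Measurable.tsum fun m ↦ by fun_prop).aestronglyMeasurable
  simp only [e]
  rw [← ofReal_integral_eq_lintegral_ofReal
    (integrable_tsum_of_summable_integral_norm hint hsum' hmeas),
    ← (hasSum_integral_of_summable_integral_norm hint hsum').tsum_eq]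
  · simp only [hF, integral_const_mul, hM]
  · refine ae_restrict_of_forall_mem hs fun x hx ↦ ?_
    simp only [← e]
    exact mul_nonneg (h0 x hx) (hw0 x hx)

lemma lintegral_exp_neg_mul_beta {α β : ℝ} (hα : 0 < α) (hβ : 0 < β) {v : ℝ} :
    ∫⁻ u in Ioo (0 : ℝ) 1, ENNReal.ofReal (exp (-(v * u)) * (u ^ (α - 1) * (1 - u) ^ (β - 1))) =
      ENNReal.ofReal (∑' m : ℕ, (-v) ^ m / m.factorial * beta (α + m) β) := by
  have hexp : ∀ u : ℝ, exp (-(v * u)) = ∑' m : ℕ, (-v) ^ m / m.factorial * u ^ m := by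
    intro u
    rw [exp_eq_exp_ℝ, NormedSpace.exp_eq_tsum_div]
    refine tsum_congr fun m ↦ ?_
    rw [← neg_mul, mul_pow]
    ring
  have hle : ∀ m : ℕ, beta (α + m) β ≤ beta α β := by
    intro m
    have h1 := rising_pos hα m
    have h2 := rising_le_rising hα.le (show α ≤ α + β by linarith) m
    have h3 := h1.trans_le h2
    have := beta_pos hα hβ
    rw [beta, show α + m + β = α + β + m by ring, Gamma_add_natCast hα,
      Gamma_add_natCast (add_pos hα hβ)]
    calc _ = rising α m / rising (α + β) m * beta α β := by
          rw [beta]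
          have := Gamma_pos_of_pos (add_pos hα hβ)
          field_simp
      _ ≤ 1 * beta α β := by
          gcongr
          exact div_le_one_of_le₀ h2 h3.le
      _ = _ := one_mul _
  have hbp : ∀ m : ℕ, 0 < beta (α + m) β := fun m ↦ beta_pos (by positivity) hβ
  simp only [hexp]
  refine lintegral_tsum_mul_pow_mul measurableSet_Ioo Ioo_subset_Ioi_self (by fun_prop)
    (fun x hx ↦ ?_) (fun m ↦ ?_) hbp ?_ fun x _ ↦ ?_
  · have := hx.1
    have : 0 < 1 - x := sub_pos.mpr hx.2
    positivity
  · rw [integral_eq_lintegral_of_nonneg_ae, ← ENNReal.toReal_ofReal (hbp m).le,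
      ← lintegral_beta_Ioo (by positivity) hβ]
    · congr 1
      refine setLIntegral_congr_fun measurableSet_Ioo fun x hx ↦ ?_
      rw [← mul_assoc, ← rpow_natCast, ← rpow_add hx.1]
      ring_nf
    · refine ae_restrict_of_forall_mem measurableSet_Ioo fun x hx ↦ ?_
      have := hx.1
      have : 0 < 1 - x := sub_pos.mpr hx.2
      positivity
    · exact Measurable.aestronglyMeasurable (by fun_prop)
  · refine .of_nonneg_of_le (fun m ↦ mul_nonneg (abs_nonneg _) (hbp m).le) (fun m ↦ ?_)
      ((Real.summable_pow_div_factorial |v|).mul_right (beta α β))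
    rw [abs_div, abs_pow, abs_neg, Nat.abs_cast]
    gcongr
    exact hle m
  · rw [← hexp]
    positivity

end Laplace

/-- The function `₁F₂(α; 3α/2, (3α + 1)/2; -x)`. -/
noncomputable def hypFun (α x : ℝ) : ℝ := ∑' m, hypCoeff α m * (-x) ^ m

@[fun_prop]
lemma measurable_hypFun (α : ℝ) : Measurable (hypFun α) :=
  Measurable.tsum fun m ↦ by fun_prop

section Mellin

open Set ProbabilityTheory

variable {α : ℝ} (hα : 1 ≤ α)

include hα

lemma hypFun_nonneg {x : ℝ} (hx : 0 ≤ x) : 0 ≤ hypFun α x := tsum_hypCoeff_nonneg hα hx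

lemma lintegral_hypFun_mul_exp_neg_mul {p : ℝ} (hp : 0 < p) :
    ENNReal.ofReal (beta α ((α + 1) / 2)) * ∫⁻ x in Ioi (0 : ℝ),
      ENNReal.ofReal (hypFun α x * (x ^ (3 * α / 2 - 1) * exp (-(p * x)))) =
    ENNReal.ofReal (Gamma (3 * α / 2) * p ^ (-(3 * α / 2))) * ∫⁻ u in Ioo (0 : ℝ) 1,
      ENNReal.ofReal (exp (-(p⁻¹ * u)) * (u ^ (α - 1) * (1 - u) ^ ((α + 1) / 2 - 1))) := by
  have hα0 : 0 < α := by linarith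
  have hβ : 0 < (α + 1) / 2 := by linarith
  have hγ : 0 < 3 * α / 2 := by linarith
  have hB := beta_pos hα0 hβ
  have hG := Gamma_pos_of_pos hγ
  have hM0 : ∀ m : ℕ, 0 < Gamma (3 * α / 2 + m) * p ^ (-(3 * α / 2 + m)) := fun m ↦
    mul_pos (Gamma_pos_of_pos (by positivity)) (by positivity)
  have hu : ∀ m, hypCoeff α m * (-1) ^ m * (Gamma (3 * α / 2 + m) * p ^ (-(3 * α / 2 + m))) =
      Gamma (3 * α / 2) * p ^ (-(3 * α / 2)) * (rising α m / rising (3 * α / 2 + 1 / 2) m *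
        ((-p⁻¹) ^ m / m.factorial)) := by
    intro m
    have := rising_pos hγ m
    have := rising_pos (show 0 < 3 * α / 2 + 1 / 2 by linarith) m
    rw [Gamma_add_natCast hγ, neg_add, rpow_add hp, rpow_neg hp.le (m : ℝ), rpow_natCast, hypCoeff,
      neg_pow p⁻¹, inv_pow]
    generalize rising (3 * α / 2) m = r at *
    generalize rising (3 * α / 2 + 1 / 2) m = r' at *
    generalize p ^ (-(3 * α / 2)) = P at *
    field_simp
  have hle : ∀ m, |rising α m / rising (3 * α / 2 + 1 / 2) m| ≤ 1 := by
    intro m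
    have h1 := rising_pos hα0 m
    have h2 := rising_le_rising hα0.le (show α ≤ 3 * α / 2 + 1 / 2 by linarith) m
    rw [abs_of_pos (div_pos h1 (h1.trans_le h2))]
    exact div_le_one_of_le₀ h2 (h1.trans_le h2).le
  have e : ∀ x, hypFun α x = ∑' m, hypCoeff α m * (-1) ^ m * x ^ m := fun x ↦
    tsum_congr fun m ↦ by rw [neg_pow, mul_assoc]
  have hL := lintegral_tsum_mul_pow_mul (s := Ioi (0 : ℝ))
    (w := fun x ↦ x ^ (3 * α / 2 - 1) * exp (-(p * x)))
    (M := fun m ↦ Gamma (3 * α / 2 + m) * p ^ (-(3 * α / 2 + m)))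
    (u := fun m ↦ hypCoeff α m * (-1) ^ m) measurableSet_Ioi subset_rfl (by fun_prop)
    (fun x hx ↦ ?_) (fun m ↦ ?_) hM0 ?_ fun x hx ↦ ?_
  · simp only [e]
    rw [hL, lintegral_exp_neg_mul_beta hα0 hβ, ← ENNReal.ofReal_mul hB.le,
      ← ENNReal.ofReal_mul (by positivity), ← tsum_mul_left, ← tsum_mul_left]
    congr 1
    refine tsum_congr fun m ↦ ?_
    rw [hu, beta, beta, show α + m + (α + 1) / 2 = 3 * α / 2 + 1 / 2 + m by ring,
      Gamma_add_natCast hα0, show α + (α + 1) / 2 = 3 * α / 2 + 1 / 2 by ring,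
      Gamma_add_natCast (show 0 < 3 * α / 2 + 1 / 2 by linarith)]
    ring
  · have : 0 < x := hx
    positivity
  · rw [mul_comm (Gamma _), rpow_neg hp.le, ← inv_rpow hp.le, ← one_div,
      ← integral_rpow_mul_exp_neg_mul_Ioi (by positivity) hp]
    refine setIntegral_congr_fun measurableSet_Ioi fun x hx ↦ ?_
    have hx' : 0 < x := hx
    rw [← mul_assoc, ← rpow_natCast, ← rpow_add hx']
    ring_nf
  · refine .of_nonneg_of_le (fun m ↦ mul_nonneg (abs_nonneg _) (hM0 m).le) (fun m ↦ ?_)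
      ((Real.summable_pow_div_factorial p⁻¹).mul_left (Gamma (3 * α / 2) * p ^ (-(3 * α / 2))))
    have hpos : 0 < Gamma (3 * α / 2) * p ^ (-(3 * α / 2)) := by positivity
    rw [← abs_of_pos (hM0 m), ← abs_mul, hu, abs_mul, abs_of_pos hpos, abs_mul, abs_div _ (m.factorial : ℝ),
      abs_pow, abs_neg, abs_of_pos (inv_pos.mpr hp), Nat.abs_cast]
    gcongr
    exact mul_le_of_le_one_left (by positivity) (hle m)
  · rw [← e]
    exact hypFun_nonneg hα (le_of_lt hx)

lemma lintegral_rpow_mul_hypFun {t : ℝ} (ht : 0 < t) (htα : t < α) :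
    ∫⁻ x in Ioi (0 : ℝ), ENNReal.ofReal (x ^ (t - 1) * hypFun α x) =
      ENNReal.ofReal (Gamma (3 * α / 2) * Gamma t * beta (α - t) ((α + 1) / 2) /
        (beta α ((α + 1) / 2) * Gamma (3 * α / 2 - t))) := by
  have hα0 : 0 < α := by linarith
  have hβ : 0 < (α + 1) / 2 := by linarith
  have hγ : 0 < 3 * α / 2 := by linarith
  have hw : 0 < 3 * α / 2 - t := by linarith
  have hB := beta_pos hα0 hβ
  have hB' := beta_pos (sub_pos.mpr htα) hβ
  have hG := Gamma_pos_of_pos hγ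
  have hGt := Gamma_pos_of_pos ht
  have hGw := Gamma_pos_of_pos hw
  have hleft : ∫⁻ p in Ioi (0 : ℝ), ENNReal.ofReal (p ^ (3 * α / 2 - t - 1)) *
      ∫⁻ x in Ioi (0 : ℝ), ENNReal.ofReal (hypFun α x * (x ^ (3 * α / 2 - 1) * exp (-(p * x)))) =
      ENNReal.ofReal (Gamma (3 * α / 2 - t)) *
        ∫⁻ x in Ioi (0 : ℝ), ENNReal.ofReal (x ^ (t - 1) * hypFun α x) := by
    simp only [← lintegral_const_mul' _ _ ENNReal.ofReal_ne_top]
    rw [lintegral_lintegral_swap (Measurable.aemeasurable (by fun_prop))]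
    refine setLIntegral_congr_fun measurableSet_Ioi fun x hx ↦ ?_
    have hx' : 0 < x := hx
    have hf := hypFun_nonneg hα hx'.le
    have e : ∀ p ∈ Ioi (0 : ℝ), ENNReal.ofReal (p ^ (3 * α / 2 - t - 1)) *
        ENNReal.ofReal (hypFun α x * (x ^ (3 * α / 2 - 1) * exp (-(p * x)))) =
        ENNReal.ofReal (hypFun α x * x ^ (3 * α / 2 - 1)) *
          ENNReal.ofReal (p ^ (3 * α / 2 - t - 1) * exp (-(x * p))) := by
      intro p hp
      have hp' : 0 < p := hp
      rw [← ENNReal.ofReal_mul (by positivity), ← ENNReal.ofReal_mul (by positivity), mul_comm x p]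
      ring_nf
    rw [setLIntegral_congr_fun measurableSet_Ioi e, lintegral_const_mul' _ _ ENNReal.ofReal_ne_top,
      lintegral_rpow_mul_exp_neg_mul_Ioi hw hx', ← ENNReal.ofReal_mul (by positivity),
      ← ENNReal.ofReal_mul (by positivity)]
    rw [show t - 1 = 3 * α / 2 - 1 + -(3 * α / 2 - t) by ring, rpow_add hx' (3 * α / 2 - 1)]
    ring_nf
  have hright : ∫⁻ p in Ioi (0 : ℝ), ENNReal.ofReal (p ^ (3 * α / 2 - t - 1)) *
      (ENNReal.ofReal (Gamma (3 * α / 2) * p ^ (-(3 * α / 2))) * ∫⁻ u in Ioo (0 : ℝ) 1,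
        ENNReal.ofReal (exp (-(p⁻¹ * u)) * (u ^ (α - 1) * (1 - u) ^ ((α + 1) / 2 - 1)))) =
      ENNReal.ofReal (Gamma (3 * α / 2) * Gamma t * beta (α - t) ((α + 1) / 2)) := by
    simp only [← lintegral_const_mul' _ _ ENNReal.ofReal_ne_top]
    rw [lintegral_lintegral_swap (Measurable.aemeasurable (by fun_prop)),
      ENNReal.ofReal_mul (by positivity), ← lintegral_beta_Ioo (sub_pos.mpr htα) hβ,
      ← lintegral_const_mul' _ _ ENNReal.ofReal_ne_top]
    refine setLIntegral_congr_fun measurableSet_Ioo fun u hu ↦ ?_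
    have hu0 := hu.1
    have hu1 : 0 < 1 - u := sub_pos.mpr hu.2
    have e : ∀ p ∈ Ioi (0 : ℝ), ENNReal.ofReal (p ^ (3 * α / 2 - t - 1)) *
        (ENNReal.ofReal (Gamma (3 * α / 2) * p ^ (-(3 * α / 2))) *
        ENNReal.ofReal (exp (-(p⁻¹ * u)) * (u ^ (α - 1) * (1 - u) ^ ((α + 1) / 2 - 1)))) =
        ENNReal.ofReal (Gamma (3 * α / 2) * (u ^ (α - 1) * (1 - u) ^ ((α + 1) / 2 - 1))) *
          ENNReal.ofReal (p ^ (-t - 1) * exp (-(u / p))) := by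
      intro p hp
      have hp' : 0 < p := hp
      rw [← ENNReal.ofReal_mul (by positivity), ← ENNReal.ofReal_mul (by positivity),
        ← ENNReal.ofReal_mul (by positivity), show -t - 1 = 3 * α / 2 - t - 1 + -(3 * α / 2) by ring,
        rpow_add hp' (3 * α / 2 - t - 1), div_eq_inv_mul]
      ring_nf
    rw [setLIntegral_congr_fun measurableSet_Ioi e, lintegral_const_mul' _ _ ENNReal.ofReal_ne_top,
      lintegral_rpow_mul_exp_neg_div_Ioi ht hu0, ← ENNReal.ofReal_mul (by positivity),
      ← ENNReal.ofReal_mul (by positivity)]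
    rw [show α - t - 1 = α - 1 + -t by ring, rpow_add hu0 (α - 1)]
    ring_nf
  have key : ENNReal.ofReal (beta α ((α + 1) / 2) * Gamma (3 * α / 2 - t)) *
      ∫⁻ x in Ioi (0 : ℝ), ENNReal.ofReal (x ^ (t - 1) * hypFun α x) =
      ENNReal.ofReal (Gamma (3 * α / 2) * Gamma t * beta (α - t) ((α + 1) / 2)) := by
    rw [ENNReal.ofReal_mul hB.le, mul_assoc, ← hleft, ← hright,
      ← lintegral_const_mul' _ _ ENNReal.ofReal_ne_top]
    refine setLIntegral_congr_fun measurableSet_Ioi fun p hp ↦ ?_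
    rw [← lintegral_hypFun_mul_exp_neg_mul hα hp]
    ring
  exact eq_ofReal_div_of_ofReal_mul_eq (by positivity) key

end Mellin

section Existence

open Set ProbabilityTheory

variable {a b c : ℝ} (ha : 0 < a) (hb : 0 < b)

include ha hb

lemma XExists.of_lintegral_rpow (hc : 0 < c) {K : ℝ} (hK : 0 < K) {N : Measure ℝ}
    (hN : N (Ioi (0 : ℝ))ᶜ = 0)
    (h : ∀ s ∈ Ioo (-a) b, ∫⁻ x, ENNReal.ofReal (x ^ s) ∂N =
      ENNReal.ofReal (K * (Gamma (a + s) * Gamma (b - s) / Gamma (c + 2 * s)))) :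
    XExists a b c 2 := by
  have hGa := Gamma_pos_of_pos ha
  have hGb := Gamma_pos_of_pos hb
  have hGc := Gamma_pos_of_pos hc
  have h0 := h 0 ⟨by linarith, hb⟩
  simp only [rpow_zero, ENNReal.ofReal_one, lintegral_one, add_zero, sub_zero, mul_zero] at h0
  refine ⟨ENNReal.ofReal (Gamma c / (Gamma a * Gamma b) / K) • N, ⟨?_⟩, ?_, fun s hs ↦ ?_⟩
  · rw [Measure.smul_apply, h0, smul_eq_mul, ← ENNReal.ofReal_mul (by positivity),
      ← ENNReal.ofReal_one]
    congr 1
    field_simp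
  · rw [Measure.smul_apply, hN, smul_zero]
  · rw [lintegral_smul_measure, h s hs, smul_eq_mul, ← ENNReal.ofReal_mul (by positivity)]
    congr 1
    field_simp

lemma xExists_three_mul_add (hab : 1 ≤ a + b) : XExists a b (3 * a + b) 2 := by
  have hγ : 0 < 3 * (a + b) / 2 := by linarith
  have hβ : 0 < (a + b + 1) / 2 := by linarith
  have hB := beta_pos (show 0 < a + b by linarith) hβ
  have hGγ := Gamma_pos_of_pos hγ
  have hGβ := Gamma_pos_of_pos hβ
  set f : ℝ → ENNReal := fun x ↦ ENNReal.ofReal (x ^ (b - 1) * hypFun (a + b) x) with hf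
  have hfm : Measurable f := by fun_prop
  refine XExists.of_lintegral_rpow ha hb (c := 3 * a + b) (by positivity)
    (K := Gamma (3 * (a + b) / 2) * Gamma ((a + b + 1) / 2) /
      (beta (a + b) ((a + b + 1) / 2) * (2 ^ (1 - (3 * a + b)) * √π)))
    (N := ((volume.restrict (Ioi 0)).withDensity f).map fun x ↦ (4 * x)⁻¹)
    (by positivity) ?_ fun s hs ↦ ?_
  · rw [Measure.map_apply (by fun_prop) measurableSet_Ioi.compl]
    refine withDensity_absolutelyContinuous _ _ ?_
    rw [Measure.restrict_apply (measurableSet_Ioi.compl.preimage (by fun_prop))]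
    convert! measure_empty (μ := volume)
    ext x
    simp only [mem_inter_iff, mem_preimage, mem_compl_iff, mem_Ioi, mem_empty_iff_false, iff_false]
    rintro ⟨h, hx⟩
    exact h (by positivity)
  · have hz : 0 < (3 * a + b) / 2 + s := by linarith [hs.1]
    have hGz := Gamma_pos_of_pos hz
    have hGz' := Gamma_pos_of_pos (show 0 < (3 * a + b) / 2 + s + 1 / 2 by linarith)
    have hGz2 := Gamma_pos_of_pos (show 0 < 3 * a + b + 2 * s by linarith [hs.1])
    have h4 : (0 : ℝ) < 4 ^ (-s) := by positivity
    have hdup := Gamma_mul_Gamma_add_half ((3 * a + b) / 2 + s)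
    rw [show 2 * ((3 * a + b) / 2 + s) = 3 * a + b + 2 * s by ring,
      show 1 - (3 * a + b + 2 * s) = 1 - (3 * a + b) + 2 * (-s) by ring, rpow_add two_pos,
      rpow_mul two_pos.le, show (2 : ℝ) ^ (2 : ℝ) = 4 by norm_num] at hdup
    rw [lintegral_map (by fun_prop) (by fun_prop), lintegral_withDensity_eq_lintegral_mul _ hfm
      (by fun_prop)]
    have e : ∀ x ∈ Ioi (0 : ℝ), (f * fun x : ℝ ↦ ENNReal.ofReal ((4 * x)⁻¹ ^ s)) x =
        ENNReal.ofReal (4 ^ (-s)) *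
          ENNReal.ofReal (x ^ (b - s - 1) * hypFun (a + b) x) := by
      intro x hx
      have hx' : 0 < x := hx
      have := hypFun_nonneg hab hx'.le
      simp only [Pi.mul_apply, hf]
      rw [← ENNReal.ofReal_mul (by positivity), ← ENNReal.ofReal_mul (by positivity),
        inv_rpow (by positivity), ← rpow_neg (by positivity), mul_rpow (by norm_num) hx'.le,
        show b - s - 1 = b - 1 + -s by ring, rpow_add hx']
      ring_nf
    rw [setLIntegral_congr_fun measurableSet_Ioi e, lintegral_const_mul' _ _ ENNReal.ofReal_ne_top,
      lintegral_rpow_mul_hypFun hab (by linarith [hs.2]) (by linarith [hs.1]),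
      ← ENNReal.ofReal_mul (by positivity)]
    congr 1
    rw [show a + b - (b - s) = a + s by ring, beta.eq_1 (a + s),
      show a + s + (a + b + 1) / 2 = (3 * a + b) / 2 + s + 1 / 2 by ring,
      show 3 * (a + b) / 2 - (b - s) = (3 * a + b) / 2 + s by ring]
    have hrw : (4 : ℝ) ^ (-s) / (Gamma ((3 * a + b) / 2 + s) * Gamma ((3 * a + b) / 2 + s + 1 / 2)) =
        1 / (Gamma (3 * a + b + 2 * s) * (2 ^ (1 - (3 * a + b)) * √π)) := by
      rw [hdup]
      field_simp
    calc _ = Gamma (3 * (a + b) / 2) * Gamma (b - s) * Gamma (a + s) * Gamma ((a + b + 1) / 2) /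
          beta (a + b) ((a + b + 1) / 2) * (4 ^ (-s) /
          (Gamma ((3 * a + b) / 2 + s) * Gamma ((3 * a + b) / 2 + s + 1 / 2))) := by
          field_simp
      _ = _ := by
          rw [hrw]
          field_simp

omit ha hb in
lemma lintegral_rpow_betaMeasure {α β t : ℝ} (hα : 0 < α) (hβ : 0 < β) (ht : 0 < α + t) :
    ∫⁻ y, ENNReal.ofReal (y ^ t) ∂betaMeasure α β =
      ENNReal.ofReal (beta (α + t) β / beta α β) := by
  have hB := beta_pos hα hβ
  have hm : Measurable (betaPDF α β) := (measurable_betaPDFReal α β).ennreal_ofReal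
  rw [betaMeasure, lintegral_withDensity_eq_lintegral_mul _ hm (by fun_prop)]
  have e : ∀ y, (betaPDF α β * fun y : ℝ ↦ ENNReal.ofReal (y ^ t)) y = (Ioo (0 : ℝ) 1).indicator
      (fun y ↦ ENNReal.ofReal (1 / beta α β) *
        ENNReal.ofReal (y ^ (α + t - 1) * (1 - y) ^ (β - 1))) y := by
    intro y
    rw [Pi.mul_apply, betaPDF_eq, indicator_apply]
    by_cases hy : 0 < y ∧ y < 1
    · have hy0 := hy.1
      have hy1 : 0 < 1 - y := sub_pos.mpr hy.2
      rw [if_pos hy, if_pos (show y ∈ Ioo 0 1 from hy), ← ENNReal.ofReal_mul (by positivity),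
        ← ENNReal.ofReal_mul (by positivity), show α + t - 1 = α - 1 + t by ring, rpow_add hy0]
      ring_nf
    · rw [if_neg hy, if_neg (show y ∉ Ioo 0 1 from hy), ENNReal.ofReal_zero, zero_mul]
  simp only [e]
  rw [lintegral_indicator measurableSet_Ioo, lintegral_const_mul' _ _ ENNReal.ofReal_ne_top,
    lintegral_beta_Ioo ht hβ, ← ENNReal.ofReal_mul (by positivity)]
  ring_nf

lemma XExists.of_lt {c₀ : ℝ} (hc₀ : 2 * a ≤ c₀) (hlt : c₀ < c) (h : XExists a b c₀ 2) :
    XExists a b c 2 := by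
  obtain ⟨μ, hμ, hμ0, hmom⟩ := h
  have hδ := sub_pos.mpr hlt
  have hc₀' : 0 < c₀ := by linarith
  have hB := beta_pos hc₀' hδ
  have := isProbabilityMeasureBeta hc₀' hδ
  have hGa := Gamma_pos_of_pos ha
  have hGb := Gamma_pos_of_pos hb
  have hGc := Gamma_pos_of_pos hc₀'
  have hGd := Gamma_pos_of_pos hδ
  have hμpos : ∀ᵐ x ∂μ, 0 < x := hμ0
  have hνpos : ∀ᵐ y ∂betaMeasure c₀ (c - c₀), 0 < y := by
    refine (ae_withDensity_iff ((measurable_betaPDFReal _ _).ennreal_ofReal)).mpr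
      (.of_forall fun y hy ↦ ?_)
    by_contra hy0
    exact hy (betaPDF_eq_zero_of_nonpos (not_lt.mp hy0))
  have hpos : ∀ᵐ p ∂μ.prod (betaMeasure c₀ (c - c₀)), 0 < p.1 ∧ 0 < p.2 :=
    (Measure.quasiMeasurePreserving_fst.ae hμpos).and
      (Measure.quasiMeasurePreserving_snd.ae hνpos)
  refine XExists.of_lintegral_rpow ha hb (c := c) (by linarith)
    (K := Gamma c₀ / (Gamma a * Gamma b) * (Gamma (c - c₀) / beta c₀ (c - c₀)))
    (N := (μ.prod (betaMeasure c₀ (c - c₀))).map fun p ↦ p.1 * p.2 ^ 2) (by positivity) ?_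
    fun s hs ↦ ?_
  · refine (ae_map_iff (p := fun x : ℝ ↦ x ∈ Ioi 0) (by fun_prop) measurableSet_Ioi).mpr ?_
    filter_upwards [hpos] with p hp
    have := hp.1
    have := hp.2
    exact show 0 < p.1 * p.2 ^ 2 by positivity
  · have hcs : 0 < c₀ + 2 * s := by linarith [hs.1]
    have hGs := Gamma_pos_of_pos hcs
    have hGs' := Gamma_pos_of_pos (show 0 < c + 2 * s by linarith)
    rw [lintegral_map (by fun_prop) (by fun_prop)]
    have e : ∫⁻ p, ENNReal.ofReal ((p.1 * p.2 ^ 2) ^ s) ∂μ.prod (betaMeasure c₀ (c - c₀)) =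
        ∫⁻ p, ENNReal.ofReal (p.1 ^ s) * ENNReal.ofReal (p.2 ^ (2 * s))
          ∂μ.prod (betaMeasure c₀ (c - c₀)) := by
      refine lintegral_congr_ae ?_
      filter_upwards [hpos] with p hp
      rw [mul_rpow hp.1.le (by positivity), ENNReal.ofReal_mul (rpow_nonneg hp.1.le _),
        rpow_mul hp.2.le, rpow_two]
    rw [e, lintegral_prod_mul (f := fun x : ℝ ↦ ENNReal.ofReal (x ^ s))
      (g := fun y : ℝ ↦ ENNReal.ofReal (y ^ (2 * s))) (by fun_prop) (by fun_prop), hmom s hs,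
      lintegral_rpow_betaMeasure hc₀' hδ hcs, ← ENNReal.ofReal_mul' (by
        have := beta_pos hcs hδ; positivity), beta.eq_1 (c₀ + 2 * s),
        show c₀ + 2 * s + (c - c₀) = c + 2 * s by ring]
    congr 1
    generalize Gamma (c₀ + 2 * s) = g at *
    field_simp

end Existence

section Uniqueness

open Set ProbabilityTheory Filter Topology

lemma AnalyticOnNhd.eqOn_of_eventuallyEq_ofReal {f g : ℂ → ℂ} {U : Set ℂ}
    (hf : AnalyticOnNhd ℂ f U) (hg : AnalyticOnNhd ℂ g U) (hU : IsPreconnected U) {t : ℝ}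
    (ht : (t : ℂ) ∈ U) (h : ∀ᶠ x : ℝ in 𝓝 t, f x = g x) : EqOn f g U := by
  refine hf.eqOn_of_preconnected_of_frequently_eq hg hU ht ?_
  have h1 : Tendsto ((↑) : ℝ → ℂ) (𝓝[≠] t) (𝓝[≠] (t : ℂ)) :=
    tendsto_nhdsWithin_of_tendsto_nhds_of_eventually_within _
      ((Complex.continuous_ofReal.tendsto t).mono_left nhdsWithin_le_nhds)
      (eventually_mem_nhdsWithin.mono fun x hx ↦ by simpa using hx)
  exact h1.frequently (h.filter_mono nhdsWithin_le_nhds).frequently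

lemma integrable_exp_mul_log_and_mgf {ρ : Measure ℝ} (h0 : ρ (Ioi (0 : ℝ))ᶜ = 0) {t : ℝ}
    (hfin : ∫⁻ x, ENNReal.ofReal (x ^ t) ∂ρ ≠ ⊤) :
    t ∈ integrableExpSet log ρ ∧ mgf log ρ t = (∫⁻ x, ENNReal.ofReal (x ^ t) ∂ρ).toReal := by
  have hpos : ∀ᵐ x ∂ρ, 0 < x := h0
  have e : ∫⁻ x, ENNReal.ofReal (exp (t * log x)) ∂ρ = ∫⁻ x, ENNReal.ofReal (x ^ t) ∂ρ := by
    refine lintegral_congr_ae ?_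
    filter_upwards [hpos] with x hx
    rw [rpow_def_of_pos hx, mul_comm]
  have hm : AEStronglyMeasurable (fun x ↦ exp (t * log x)) ρ :=
    Measurable.aestronglyMeasurable (by fun_prop)
  refine ⟨(lintegral_ofReal_ne_top_iff_integrable hm (ae_of_all _ fun x ↦ (exp_nonneg _))).mp
    (by rwa [e]), ?_⟩
  rw [mgf, integral_eq_lintegral_of_nonneg_ae (ae_of_all _ fun x ↦ (exp_nonneg _)) hm, e]

lemma MeasureTheory.Measure.ext_of_lintegral_rpow_eq {ρ₁ ρ₂ : Measure ℝ} (h₁ : ρ₁ (Ioi (0 : ℝ))ᶜ = 0)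
    (h₂ : ρ₂ (Ioi (0 : ℝ))ᶜ = 0) {ε₁ ε₂ : ℝ} (hε₁ : ε₁ < 0) (hε₂ : 0 < ε₂)
    (hfin : ∀ t ∈ Ioo ε₁ ε₂, ∫⁻ x, ENNReal.ofReal (x ^ t) ∂ρ₁ ≠ ⊤)
    (h : ∀ t ∈ Ioo ε₁ ε₂, ∫⁻ x, ENNReal.ofReal (x ^ t) ∂ρ₁ = ∫⁻ x, ENNReal.ofReal (x ^ t) ∂ρ₂) :
    ρ₁ = ρ₂ := by
  have hfin₂ : ∀ t ∈ Ioo ε₁ ε₂, ∫⁻ x, ENNReal.ofReal (x ^ t) ∂ρ₂ ≠ ⊤ := fun t ht ↦ by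
    rw [← h t ht]
    exact hfin t ht
  have hF₁ : IsFiniteMeasure ρ₁ := ⟨by
    have := hfin 0 ⟨hε₁, hε₂⟩
    simpa [lt_top_iff_ne_top] using this⟩
  have hF₂ : IsFiniteMeasure ρ₂ := ⟨by
    have := hfin₂ 0 ⟨hε₁, hε₂⟩
    simpa [lt_top_iff_ne_top] using this⟩
  let U : Set ℂ := {z | z.re ∈ Ioo ε₁ ε₂}
  have hU : IsPreconnected U :=
    ((convex_Ioo ε₁ ε₂).linear_preimage Complex.reLm).isPreconnected
  have hsub₁ : Ioo ε₁ ε₂ ⊆ interior (integrableExpSet log ρ₁) :=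
    interior_maximal (fun t ht ↦ (integrable_exp_mul_log_and_mgf h₁ (hfin t ht)).1) isOpen_Ioo
  have hsub₂ : Ioo ε₁ ε₂ ⊆ interior (integrableExpSet log ρ₂) :=
    interior_maximal (fun t ht ↦ (integrable_exp_mul_log_and_mgf h₂ (hfin₂ t ht)).1) isOpen_Ioo
  have heq : EqOn (complexMGF log ρ₁) (complexMGF log ρ₂) U := by
    refine AnalyticOnNhd.eqOn_of_eventuallyEq_ofReal
      (analyticOnNhd_complexMGF.mono fun z hz ↦ hsub₁ hz)
      (analyticOnNhd_complexMGF.mono fun z hz ↦ hsub₂ hz) hU (t := 0) ⟨by simpa, by simpa⟩ ?_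
    filter_upwards [Ioo_mem_nhds hε₁ hε₂] with t ht
    rw [complexMGF_ofReal, complexMGF_ofReal, (integrable_exp_mul_log_and_mgf h₁ (hfin t ht)).2,
      (integrable_exp_mul_log_and_mgf h₂ (hfin₂ t ht)).2, h t ht]
  have hmap : ρ₁.map log = ρ₂.map log := by
    refine Measure.ext_of_charFun (funext fun t ↦ ?_)
    rw [← complexMGF_mul_I (by fun_prop), ← complexMGF_mul_I (by fun_prop)]
    exact heq ⟨by simpa, by simpa⟩
  have hexp : ∀ {ρ : Measure ℝ}, ρ (Ioi (0 : ℝ))ᶜ = 0 → (ρ.map log).map exp = ρ := by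
    intro ρ hρ
    have hpos : ∀ᵐ x ∂ρ, 0 < x := hρ
    rw [Measure.map_map (by fun_prop) (by fun_prop)]
    conv_rhs => rw [← Measure.map_id (μ := ρ)]
    refine Measure.map_congr ?_
    filter_upwards [hpos] with x hx
    exact exp_log hx
  rw [← hexp h₁, hmap, hexp h₂]

end Uniqueness

section Necessity

open Set ProbabilityTheory Filter Topology

lemma IsXLaw.two_mul_le {a b c : ℝ} (hb : 0 < b) (hc : 0 < c) {μ : Measure ℝ}
    (h : IsXLaw a b c 2 μ) : 2 * a ≤ c := by
  obtain ⟨hμ, hμ0, hmom⟩ := h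
  have hpos : ∀ᵐ x ∂μ, 0 < x := hμ0
  by_contra! hlt
  have h0 := hmom (-(c / 2)) ⟨by linarith, by linarith⟩
  rw [show c + 2 * (-(c / 2)) = 0 by ring, Gamma_zero, div_zero, mul_zero, ENNReal.ofReal_zero,
    lintegral_eq_zero_iff (by fun_prop)] at h0
  obtain ⟨x, hx, hx0⟩ := (hpos.and h0).exists
  have : 0 < x ^ (-(c / 2)) := by positivity
  exact absurd hx0 (ENNReal.ofReal_pos.mpr this).ne'

lemma IsXLaw.lintegral_rpow_mul_exp_ae_eq {a b c : ℝ} (ha : 0 < a) (hb : 0 < b) (hc : 2 * a ≤ c)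
    {μ : Measure ℝ} (h : IsXLaw a b c 2 μ) :
    ∀ᵐ p ∂volume.restrict (Ioi (0 : ℝ)),
      ∫⁻ x, ENNReal.ofReal (x ^ (-(c / 2)) * exp (-(p * x ^ (-(1 / 2 : ℝ))))) ∂μ =
        ENNReal.ofReal (2 * (Gamma c / (Gamma a * Gamma b)) * Gamma (a + b) *
          (p ^ (2 * a - c) * (1 + p ^ 2) ^ (-(a + b)))) := by
  obtain ⟨hμ, hμ0, hmom⟩ := h
  have hpos : ∀ᵐ x ∂μ, 0 < x := hμ0
  have hGa := Gamma_pos_of_pos ha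
  have hGb := Gamma_pos_of_pos hb
  have hGab := Gamma_pos_of_pos (add_pos ha hb)
  have hGc := Gamma_pos_of_pos (show 0 < c by linarith)
  set K : ℝ := 2 * (Gamma c / (Gamma a * Gamma b)) * Gamma (a + b) with hK
  set L : ℝ → ENNReal := fun p ↦
    ∫⁻ x, ENNReal.ofReal (x ^ (-(c / 2)) * exp (-(p * x ^ (-(1 / 2 : ℝ))))) ∂μ with hL
  have hLm : Measurable L := Measurable.lintegral_prod_right (by fun_prop)
  set f₁ : ℝ → ENNReal := fun p ↦ ENNReal.ofReal (p ^ (c - 1)) * L p with hf₁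
  have hf₁m : Measurable f₁ := by fun_prop
  set f₂ : ℝ → ENNReal := fun p ↦
    ENNReal.ofReal (K * (p ^ (2 * a - 1) * (1 + p ^ 2) ^ (-(a + b)))) with hf₂
  have hf₂m : Measurable f₂ := by fun_prop
  have m₁ : ∀ t ∈ Ioo (-(2 * a)) (2 * b),
      ∫⁻ p, ENNReal.ofReal (p ^ t) ∂(volume.restrict (Ioi (0 : ℝ))).withDensity f₁ =
      ENNReal.ofReal (Gamma c / (Gamma a * Gamma b) * (Gamma (a + t / 2) * Gamma (b - t / 2))) := by
    intro t ht
    have hct : 0 < c + t := by linarith [ht.1]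
    have hGct := Gamma_pos_of_pos hct
    rw [lintegral_withDensity_eq_lintegral_mul _ hf₁m (by fun_prop)]
    have e : ∀ p ∈ Ioi (0 : ℝ), (f₁ * fun p : ℝ ↦ ENNReal.ofReal (p ^ t)) p =
        ∫⁻ x, ENNReal.ofReal (p ^ (c + t - 1)) *
          ENNReal.ofReal (x ^ (-(c / 2)) * exp (-(p * x ^ (-(1 / 2 : ℝ))))) ∂μ := by
      intro p hp
      have hp' : 0 < p := hp
      rw [lintegral_const_mul' _ _ ENNReal.ofReal_ne_top, Pi.mul_apply, hf₁,
        show c + t - 1 = c - 1 + t by ring, rpow_add hp', ENNReal.ofReal_mul (by positivity)]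
      ring
    rw [setLIntegral_congr_fun measurableSet_Ioi e,
      lintegral_lintegral_swap (Measurable.aemeasurable (by fun_prop))]
    have e2 : ∫⁻ x, (∫⁻ p in Ioi (0 : ℝ), ENNReal.ofReal (p ^ (c + t - 1)) *
          ENNReal.ofReal (x ^ (-(c / 2)) * exp (-(p * x ^ (-(1 / 2 : ℝ)))))) ∂μ =
        ∫⁻ x, ENNReal.ofReal (Gamma (c + t)) * ENNReal.ofReal (x ^ (t / 2)) ∂μ := by
      refine lintegral_congr_ae ?_
      filter_upwards [hpos] with x hx
      have e3 : ∀ p ∈ Ioi (0 : ℝ), ENNReal.ofReal (p ^ (c + t - 1)) *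
          ENNReal.ofReal (x ^ (-(c / 2)) * exp (-(p * x ^ (-(1 / 2 : ℝ))))) =
          ENNReal.ofReal (x ^ (-(c / 2))) *
          ENNReal.ofReal (p ^ (c + t - 1) * exp (-(x ^ (-(1 / 2 : ℝ)) * p))) := by
        intro p hp
        have hp' : 0 < p := hp
        rw [← ENNReal.ofReal_mul (by positivity), ← ENNReal.ofReal_mul (by positivity)]
        ring_nf
      rw [setLIntegral_congr_fun measurableSet_Ioi e3, lintegral_const_mul' _ _
        ENNReal.ofReal_ne_top, lintegral_rpow_mul_exp_neg_mul_Ioi hct (by positivity),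
        ← ENNReal.ofReal_mul (by positivity), ← ENNReal.ofReal_mul (by positivity),
        ← rpow_mul hx.le, ← mul_assoc, ← rpow_add hx]
      ring_nf
    rw [e2, lintegral_const_mul' _ _ ENNReal.ofReal_ne_top,
      hmom (t / 2) ⟨by linarith [ht.1], by linarith [ht.2]⟩, ← ENNReal.ofReal_mul (by positivity),
      show c + 2 * (t / 2) = c + t by ring]
    congr 1
    field_simp
  have m₂ : ∀ t ∈ Ioo (-(2 * a)) (2 * b),
      ∫⁻ p, ENNReal.ofReal (p ^ t) ∂(volume.restrict (Ioi (0 : ℝ))).withDensity f₂ =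
      ENNReal.ofReal (Gamma c / (Gamma a * Gamma b) * (Gamma (a + t / 2) * Gamma (b - t / 2))) := by
    intro t ht
    rw [lintegral_withDensity_eq_lintegral_mul _ hf₂m (by fun_prop)]
    have e : ∀ p ∈ Ioi (0 : ℝ), (f₂ * fun p : ℝ ↦ ENNReal.ofReal (p ^ t)) p =
        ENNReal.ofReal K * ENNReal.ofReal (p ^ (2 * (a + t / 2) - 1) *
          (1 + p ^ 2) ^ (-(a + t / 2 + (b - t / 2)))) := by
      intro p hp
      have hp' : 0 < p := hp
      rw [Pi.mul_apply, hf₂, ← ENNReal.ofReal_mul (by positivity),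
        ← ENNReal.ofReal_mul (by positivity), show 2 * (a + t / 2) - 1 = 2 * a - 1 + t by ring,
        rpow_add hp', show a + t / 2 + (b - t / 2) = a + b by ring]
      ring_nf
    rw [setLIntegral_congr_fun measurableSet_Ioi e, lintegral_const_mul' _ _ ENNReal.ofReal_ne_top,
      lintegral_rpow_mul_one_add_sq_rpow (by linarith [ht.1]) (by linarith [ht.2]),
      ← ENNReal.ofReal_mul (by positivity), show a + t / 2 + (b - t / 2) = a + b by ring]
    congr 1
    rw [hK]
    field_simp
  have hsupp : ∀ f : ℝ → ENNReal,
      (volume.restrict (Ioi (0 : ℝ))).withDensity f (Ioi (0 : ℝ))ᶜ = 0 := fun f ↦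
    withDensity_absolutelyContinuous _ _ (by
      rw [Measure.restrict_apply measurableSet_Ioi.compl, compl_inter_self, measure_empty])
  have heq := Measure.ext_of_lintegral_rpow_eq (hsupp f₁) (hsupp f₂)
    (show -(2 * a) < 0 by linarith) (show 0 < 2 * b by linarith)
    (fun t ht ↦ by rw [m₁ t ht]; exact ENNReal.ofReal_ne_top)
    (fun t ht ↦ by rw [m₁ t ht, m₂ t ht])
  rw [withDensity_eq_iff_of_sigmaFinite hf₁m.aemeasurable hf₂m.aemeasurable] at heq
  filter_upwards [heq, ae_restrict_mem measurableSet_Ioi] with p hp hp0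
  have hp' : 0 < p := hp0
  change L p = _
  rw [eq_ofReal_div_of_ofReal_mul_eq (show 0 < p ^ (c - 1) by positivity) hp,
    show 2 * a - c = 2 * a - 1 - (c - 1) by ring, rpow_sub hp' (2 * a - 1) (c - 1)]
  congr 1
  ring

lemma mgf_eqOn_of_lintegral_exp_ae_eq {Ω : Type*} [MeasurableSpace Ω] {ν : Measure Ω} {X : Ω → ℝ}
    (hX : Measurable X) {g : ℝ → ℝ} (hg : ContinuousOn g (Ioi 0)) (hg0 : ∀ p ∈ Ioi (0 : ℝ), 0 ≤ g p)
    (h : ∀ᵐ p ∂volume.restrict (Ioi (0 : ℝ)),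
      ∫⁻ x, ENNReal.ofReal (exp (p * X x)) ∂ν = ENNReal.ofReal (g p)) :
    Ioi 0 ⊆ interior (integrableExpSet X ν) ∧ EqOn (mgf X ν) g (Ioi 0) := by
  have hm : ∀ p, AEStronglyMeasurable (fun x ↦ exp (p * X x)) ν := fun p ↦
    Measurable.aestronglyMeasurable (by fun_prop)
  have hae : ∀ᵐ p ∂volume.restrict (Ioi (0 : ℝ)), p ∈ integrableExpSet X ν ∧ mgf X ν p = g p := by
    filter_upwards [h, ae_restrict_mem measurableSet_Ioi] with p hp hp0
    refine ⟨(lintegral_ofReal_ne_top_iff_integrable (hm p) (ae_of_all _ fun x ↦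
      (exp_nonneg _))).mp (by rw [hp]; exact ENNReal.ofReal_ne_top), ?_⟩
    rw [mgf, integral_eq_lintegral_of_nonneg_ae (ae_of_all _ fun x ↦ (exp_nonneg _)) (hm p), hp,
      ENNReal.toReal_ofReal (hg0 p hp0)]
  have hdense : Dense {p : ℝ | p ∈ Ioi (0 : ℝ) → p ∈ integrableExpSet X ν ∧ mgf X ν p = g p} :=
    Measure.dense_of_ae ((ae_restrict_iff' measurableSet_Ioi).mp hae)
  have hsub : Ioi 0 ⊆ interior (integrableExpSet X ν) := by
    refine interior_maximal (fun p hp ↦ ?_) isOpen_Ioi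
    obtain ⟨q, hq, hq0, hqp⟩ := hdense.exists_between (show 0 < p from hp)
    obtain ⟨r, hr, hpr, -⟩ := hdense.exists_between (show p < p + 1 by linarith)
    exact convex_integrableExpSet.ordConnected.out (hq hq0).1
      (hr (show 0 < r from lt_trans hp hpr)).1 ⟨hqp.le, hpr.le⟩
  exact ⟨hsub, Measure.eqOn_open_of_ae_eq (hae.mono fun p hp ↦ hp.2) isOpen_Ioi
    (continuousOn_mgf.mono hsub) hg⟩

lemma complexMGF_eq_of_mgf_eqOn {Ω : Type*} [MeasurableSpace Ω] {ν : Measure Ω} {X : Ω → ℝ}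
    {K r q : ℝ} (hsub : Ioi 0 ⊆ interior (integrableExpSet X ν))
    (hmgf : EqOn (mgf X ν) (fun p ↦ K * (p ^ r * (1 + p ^ 2) ^ q)) (Ioi 0)) :
    EqOn (complexMGF X ν) (fun z ↦ K * (z ^ (r : ℂ) * (1 + z ^ 2) ^ (q : ℂ))) {z | 0 < z.re} := by
  refine AnalyticOnNhd.eqOn_of_eventuallyEq_ofReal (t := 1)
    (analyticOnNhd_complexMGF.mono fun z hz ↦ hsub hz) (fun z hz ↦ ?_)
    ((convex_Ioi (0 : ℝ)).linear_preimage Complex.reLm).isPreconnected (by simp) ?_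
  · have hz' : 0 < z.re := hz
    refine analyticAt_const.mul ((analyticAt_id.cpow analyticAt_const (.inl hz)).mul
      ((analyticAt_const.add (analyticAt_id.pow 2)).cpow analyticAt_const ?_))
    rw [Complex.mem_slitPlane_iff]
    by_cases him : z.im = 0
    · left
      simp [sq, him]
      positivity
    · right
      have hzz : (1 + z ^ 2).im = 2 * (z.re * z.im) := by
        simp [sq]
        ring
      simpa [id, hzz] using ⟨hz'.ne', him⟩
  · filter_upwards [Ioi_mem_nhds one_pos] with p hp
    have hp' : 0 < p := hp
    rw [complexMGF_ofReal, hmgf hp]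
    push_cast [Complex.ofReal_cpow hp'.le, Complex.ofReal_cpow (show 0 ≤ 1 + p ^ 2 by positivity)]
    rfl

lemma le_rpow_of_mgf_eqOn {Ω : Type*} [MeasurableSpace Ω] {ν : Measure Ω} {X : Ω → ℝ}
    {K r q : ℝ} (hK : 0 < K) (hr : r ≤ 0) (hq : q ≤ 0)
    (hsub : Ioi 0 ⊆ interior (integrableExpSet X ν))
    (hmgf : EqOn (mgf X ν) (fun p ↦ K * (p ^ r * (1 + p ^ 2) ^ q)) (Ioi 0)) {p : ℝ} (hp : 0 < p)
    (hp1 : p ≤ 1) : (2 : ℝ) ^ r * 3 ^ q ≤ p ^ (r - q) := by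
  have h := norm_complexMGF_le_mgf (X := X) (μ := ν) (z := p + Complex.I)
  have hre : ((p : ℂ) + Complex.I).re = p := by simp
  rw [complexMGF_eq_of_mgf_eqOn hsub hmgf (show 0 < ((p : ℂ) + Complex.I).re by rwa [hre]), hre,
    hmgf hp] at h
  simp only [norm_mul, Complex.norm_real, Complex.norm_cpow_real, norm_eq_abs, abs_of_pos hK] at h
  have h2 := le_of_mul_le_mul_left h hK
  have e : 1 + ((p : ℂ) + Complex.I) ^ 2 = p * (p + 2 * Complex.I) := by
    linear_combination Complex.I_sq
  have hn1 : ‖(p : ℂ) + Complex.I‖ ≤ 2 :=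
    (norm_add_le _ _).trans (by simp [abs_of_pos hp]; linarith)
  have hn2 : ‖1 + ((p : ℂ) + Complex.I) ^ 2‖ ≤ 3 * p := by
    rw [e, norm_mul, Complex.norm_real, norm_eq_abs, abs_of_pos hp, mul_comm]
    gcongr
    exact (norm_add_le _ _).trans (by simp [abs_of_pos hp]; linarith)
  have hn1' : 0 < ‖(p : ℂ) + Complex.I‖ := norm_pos_iff.mpr fun h0 ↦ by
    simpa [hp.ne'] using congrArg Complex.re h0
  have hn2' : 0 < ‖1 + ((p : ℂ) + Complex.I) ^ 2‖ := norm_pos_iff.mpr fun h0 ↦ by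
    rw [e] at h0
    simpa [hp.ne'] using congrArg Complex.im h0
  have h3 : (2 : ℝ) ^ r * (3 * p) ^ q ≤ p ^ r * 1 := calc
    _ ≤ ‖(p : ℂ) + Complex.I‖ ^ r * ‖1 + ((p : ℂ) + Complex.I) ^ 2‖ ^ q :=
      mul_le_mul (rpow_le_rpow_of_nonpos hn1' hn1 hr) (rpow_le_rpow_of_nonpos hn2' hn2 hq)
        (by positivity) (by positivity)
    _ ≤ p ^ r * (1 + p ^ 2) ^ q := h2
    _ ≤ p ^ r * 1 := by
      gcongr
      exact rpow_le_one_of_one_le_of_nonpos (by nlinarith) hq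
  rw [mul_rpow (by norm_num) hp.le, ← mul_assoc] at h3
  rw [rpow_sub hp, le_div_iff₀ (by positivity)]
  linarith

lemma IsXLaw.three_mul_add_le {a b c : ℝ} (ha : 0 < a) (hb : 0 < b) (hc : 0 < c) {μ : Measure ℝ}
    (h : IsXLaw a b c 2 μ) : 3 * a + b ≤ c := by
  have hca := h.two_mul_le hb hc
  have hae := h.lintegral_rpow_mul_exp_ae_eq ha hb hca
  have hGa := Gamma_pos_of_pos ha
  have hGb := Gamma_pos_of_pos hb
  have hGab := Gamma_pos_of_pos (add_pos ha hb)
  have hGc := Gamma_pos_of_pos hc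
  have hpos : ∀ᵐ x ∂μ, 0 < x := h.2.1
  set K : ℝ := 2 * (Gamma c / (Gamma a * Gamma b)) * Gamma (a + b) with hKdef
  have hK : 0 < K := by positivity
  have hw : Measurable fun x : ℝ ↦ ENNReal.ofReal (x ^ (-(c / 2))) := by fun_prop
  obtain ⟨hsub, hmgf⟩ := mgf_eqOn_of_lintegral_exp_ae_eq
    (ν := μ.withDensity fun x ↦ ENNReal.ofReal (x ^ (-(c / 2)))) (X := fun x ↦ -x ^ (-(1 / 2 : ℝ)))
    (g := fun p ↦ K * (p ^ (2 * a - c) * (1 + p ^ 2) ^ (-(a + b)))) (by fun_prop)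
    (fun p hp ↦ by
      have hp' : p ≠ 0 := ne_of_gt hp
      have hp2 : 1 + p ^ 2 ≠ 0 := by positivity
      exact (continuousAt_const.mul ((continuousAt_id.rpow_const (.inl hp')).mul
        (ContinuousAt.rpow_const (by fun_prop) (.inl hp2)))).continuousWithinAt)
    (fun p hp ↦ by
      have hp' : 0 < p := hp
      positivity) (by
      filter_upwards [hae] with p hp
      rw [← hp, lintegral_withDensity_eq_lintegral_mul _ hw (by fun_prop)]
      refine lintegral_congr_ae ?_
      filter_upwards [hpos] with x hx
      rw [Pi.mul_apply, ← ENNReal.ofReal_mul (by positivity), mul_neg])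
  by_contra! hlt
  have hlim : Tendsto (fun p : ℝ ↦ p ^ (2 * a - c - -(a + b))) (𝓝[>] 0) (𝓝 0) := by
    have hr : 0 < 2 * a - c - -(a + b) := by linarith
    have := (continuousAt_rpow_const 0 _ (.inr hr.le)).tendsto
    rw [zero_rpow hr.ne'] at this
    exact this.mono_left nhdsWithin_le_nhds
  have hle := ge_of_tendsto hlim (by
    filter_upwards [Ioo_mem_nhdsGT (zero_lt_one (α := ℝ))] with p hp
    exact le_rpow_of_mgf_eqOn hK (by linarith) (by linarith) hsub hmgf hp.1 hp.2.le)
  exact absurd hle (not_le.mpr (by positivity))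

end Necessity

theorem XExists_d_eq_two_iff (a b c : ℝ) (ha : 0 < a) (hb : 0 < b) (hc : 0 < c)
    (hab : 1 ≤ a + b) : XExists a b c 2 ↔ 3 * a + b ≤ c := by
  refine ⟨fun ⟨μ, hμ⟩ ↦ hμ.three_mul_add_le ha hb hc, fun h ↦ ?_⟩
  have h₀ := xExists_three_mul_add ha hb hab
  rcases h.eq_or_lt with rfl | hlt
  · exact h₀
  · exact h₀.of_lt ha hb (by linarith) hlt
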